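/- arXiv:2203.08391 — 3 statements merged into one kernel-verified Lean document; each statement's English description precedes it below -/
import Mathlib

section
/- Let L ≥ 1 and let λ : Fin L → ℝ satisfy λᵢ ≥ 0 for all i, ∑ᵢ λᵢ² = M₂ and ∑ᵢ λᵢ⁴ = M₄ with M₂ > 0. Set q = ⌊M₂²/M₄⌋ (note M₄ > 0) and U = √(q(q+1)M₄ − q M₂²). Then ∑ᵢ λᵢ ≥ √(q(q M₂ + U)/(q+1)) + √((M₂ − U)/(q+1)). -/
theorem aux_exists (k : ℕ) (hk : 1 ≤ k) (x y : ℝ) (hx : 0 < x)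
    (h1 : (k : ℝ) * y ≤ x ^ 2) (h2 : x ^ 2 < ((k : ℝ) + 1) * y) (U : ℝ)
    (hU : U = Real.sqrt ((k : ℝ) * ((k : ℝ) + 1) * y - (k : ℝ) * x ^ 2)) :
    ∃ p r : ℝ, 0 ≤ r ∧ r < p ∧ k * p ^ 2 + r ^ 2 = x ∧ k * p ^ 4 + r ^ 4 = y ∧
      Real.sqrt ((k : ℝ) * ((k : ℝ) * x + U) / ((k : ℝ) + 1)) = k * p ∧
      Real.sqrt ((x - U) / ((k : ℝ) + 1)) = r := by
  have hK : (1 : ℝ) ≤ k := by exact_mod_cast hk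
  generalize (k : ℝ) = K at *
  have hK0 : 0 < K := by linarith
  have hin : 0 < K * (K + 1) * y - K * x ^ 2 := by nlinarith
  have hU0 : 0 < U := by rw [hU]; exact Real.sqrt_pos.mpr hin
  have hUsq : U ^ 2 = K * (K + 1) * y - K * x ^ 2 := by
    rw [hU]; exact Real.sq_sqrt hin.le
  have hUx : U ≤ x := by
    rw [← sq_le_sq₀ hU0.le hx.le]
    rw [hUsq]; nlinarith
  have hP : 0 ≤ (K * x + U) / (K * (K + 1)) := by positivity
  have hR : 0 ≤ (x - U) / (K + 1) := div_nonneg (by linarith) (by linarith)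
  have e1 : (Real.sqrt ((K * x + U) / (K * (K + 1)))) ^ 2 = (K * x + U) / (K * (K + 1)) :=
    Real.sq_sqrt hP
  have e2 : (Real.sqrt ((x - U) / (K + 1))) ^ 2 = (x - U) / (K + 1) := Real.sq_sqrt hR
  refine ⟨Real.sqrt ((K * x + U) / (K * (K + 1))), Real.sqrt ((x - U) / (K + 1)),
    Real.sqrt_nonneg _, ?_, ?_, ?_, ?_, rfl⟩
  · apply Real.sqrt_lt_sqrt hR
    rw [div_lt_div_iff₀ (by positivity) (by positivity)]
    have : 0 < (K + 1) * ((K + 1) * U) := by positivity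
    nlinarith
  · rw [e1, e2]; field_simp; ring
  · have f1 : ∀ t : ℝ, t ^ 4 = (t ^ 2) ^ 2 := fun t => by ring
    rw [f1, f1, e1, e2]; field_simp
    linear_combination (K + 1) * hUsq
  · rw [show K * (K * x + U) / (K + 1) = K ^ 2 * ((K * x + U) / (K * (K + 1))) by
      field_simp]
    rw [Real.sqrt_mul (by positivity), Real.sqrt_sq hK0.le]

theorem aux_floor (x y : ℝ) (hy : 0 < y) (hxy : y ≤ x ^ 2) (k : ℕ)
    (hk : k = ⌊x ^ 2 / y⌋₊) :
    1 ≤ k ∧ (k : ℝ) * y ≤ x ^ 2 ∧ x ^ 2 < ((k : ℝ) + 1) * y := by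
  have h0 : (0:ℝ) ≤ x ^ 2 / y := by positivity
  refine ⟨?_, ?_, ?_⟩
  · rw [hk]; apply Nat.le_floor; rw [Nat.cast_one, le_div_iff₀ hy]; linarith
  · rw [← le_div_iff₀ hy, hk]; exact Nat.floor_le h0
  · rw [← div_lt_iff₀ hy, hk]; exact Nat.lt_floor_add_one _

/-- the two large values are at least `p`, the two small ones at most `r` (squared variables) -/
theorem aux_sep (K A B C P R : ℝ) (hK : 1 ≤ K) (hC : 0 ≤ C) (hCB : C ≤ B) (hBA : B ≤ A)
    (hR : 0 < R) (hRP : R < P) (h1 : K * A + B + C = K * P + R)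
    (h2 : K * A ^ 2 + B ^ 2 + C ^ 2 = K * P ^ 2 + R ^ 2) : P ≤ A ∧ B ≤ R := by
  have hPA : P ≤ A := by
    by_contra! hlt
    have he : 0 < K * (P - A) := mul_pos (by linarith) (by linarith)
    have hs : K * (P - A) = B + C - R := by linarith
    have h3 : 2 * (B * C) = (B + C - R) * (B + C + R - P - A) := by
      rw [← hs]; linear_combination (B + C + K * P + R - K * A) * h1 - h2 - (K * (P - A)) * h1
    have h4 : A * (B + C - A) ≤ B * C := by nlinarith
    rw [hs] at he
    have h5 : 2 * (B * C) < (B + C - R) * (B + C - A) := by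
      rw [h3]; exact mul_lt_mul_of_pos_left (by linarith) he
    have h6 : (B + C - R) * (B + C - A) ≤ 2 * A * (B + C - A) ∨ B + C - A < 0 := by
      by_cases h : 0 ≤ B + C - A
      · left; exact mul_le_mul_of_nonneg_right (by linarith) h
      · right; linarith
    rcases h6 with h6 | h6
    · linarith
    · have : 0 ≤ B * C := mul_nonneg (by linarith) hC
      nlinarith
  refine ⟨hPA, ?_⟩
  have : 0 ≤ K * (A - P) := mul_nonneg (by linarith) (by linarith)
  linarith

set_option maxHeartbeats 2000000 in
theorem aux_three (j k : ℕ) (hj : 1 ≤ j) (hk : 1 ≤ k) (a b c p r : ℝ) (hc : 0 ≤ c)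
    (hcb : c ≤ b) (hba : b ≤ a) (ha : 0 < a) (hr : 0 < r) (hrp : r < p)
    (h2 : j * a ^ 2 + b ^ 2 + c ^ 2 = k * p ^ 2 + r ^ 2)
    (h4 : j * a ^ 4 + b ^ 4 + c ^ 4 = k * p ^ 4 + r ^ 4) :
    k * p + r ≤ j * a + b + c := by
  have hJ : (1 : ℝ) ≤ j := by exact_mod_cast hj
  have hK : (1 : ℝ) ≤ k := by exact_mod_cast hk
  have f1 : ∀ t : ℝ, t ^ 4 = (t ^ 2) ^ 2 := fun t => by ring
  have hb : 0 ≤ b := hc.trans hcb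
  have hp : 0 < p := hr.trans hrp
  have hCB : c ^ 2 ≤ b ^ 2 := by gcongr
  have hBA : b ^ 2 ≤ a ^ 2 := by gcongr
  have hC : 0 ≤ c ^ 2 := by positivity
  have hA : 0 < a ^ 2 := by positivity
  have hR : 0 < r ^ 2 := by positivity
  have hRP : r ^ 2 < p ^ 2 := by gcongr
  have g4 := h4
  simp only [f1] at g4
  have hM4 : 0 < (k:ℝ) * (p ^ 2) ^ 2 + (r ^ 2) ^ 2 := by positivity
  have sep := aux_sep k (a^2) (b^2) (c^2) (p^2) (r^2) hK hC hCB hBA hR hRP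
  have hjk : j ≤ k := by
    have u1 : (j:ℝ) * (k * (p ^ 2) ^ 2 + (r ^ 2) ^ 2) ≤ (k * p ^ 2 + r ^ 2) ^ 2 := by
      rw [← g4, ← h2]
      generalize a ^ 2 = A at *
      generalize b ^ 2 = B at *
      generalize c ^ 2 = C at *
      have v1 : 0 ≤ (j:ℝ) * (B * (A - B)) :=
        mul_nonneg (by linarith) (mul_nonneg (by linarith) (by linarith))
      have v2 : 0 ≤ (j:ℝ) * (C * (A - C)) :=
        mul_nonneg (by linarith) (mul_nonneg (by linarith) (by linarith))
      have v3 : 0 ≤ (j:ℝ) * (A * (B + C)) :=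
        mul_nonneg (by linarith) (mul_nonneg (by linarith) (by linarith))
      nlinarith [sq_nonneg (B + C)]
    have u2 : ((k:ℝ) * p ^ 2 + r ^ 2) ^ 2 < (k + 1) * (k * (p ^ 2) ^ 2 + (r ^ 2) ^ 2) := by
      have : 0 < (k:ℝ) * (p ^ 2 - r ^ 2) ^ 2 :=
        mul_pos (by linarith) (pow_pos (by linarith) 2)
      nlinarith
    have u3 : (j:ℝ) < k + 1 := lt_of_mul_lt_mul_right (u1.trans_lt u2) hM4.le
    have : j < k + 1 := by exact_mod_cast u3
    omega
  have hkj : k ≤ j + 1 := by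
    have u1 : (k:ℝ) * (k * (p ^ 2) ^ 2 + (r ^ 2) ^ 2) < (k * p ^ 2 + r ^ 2) ^ 2 := by
      have : 0 < (k:ℝ) * (r ^ 2 * (p ^ 2 - r ^ 2)) :=
        mul_pos (by linarith) (mul_pos hR (by linarith))
      have : 0 < (k:ℝ) * (r ^ 2 * p ^ 2) := by positivity
      nlinarith
    have u2 : ((k:ℝ) * p ^ 2 + r ^ 2) ^ 2 ≤ (j + 2) * (k * (p ^ 2) ^ 2 + (r ^ 2) ^ 2) := by
      rw [← g4, ← h2]
      have v1 : 0 ≤ (j:ℝ) * (a ^ 2 - b ^ 2) ^ 2 := by positivity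
      have v2 : 0 ≤ (j:ℝ) * (a ^ 2 - c ^ 2) ^ 2 := by positivity
      nlinarith [sq_nonneg (b ^ 2 - c ^ 2)]
    have u3 : (k:ℝ) < j + 2 := lt_of_mul_lt_mul_right (u1.trans_le u2) hM4.le
    have : k < j + 2 := by exact_mod_cast u3
    omega
  rcases Nat.lt_or_ge j k with hlt | hge
  · have hkj' : k = j + 1 := by omega
    have hkr : (k:ℝ) = j + 1 := by rw [hkj']; push_cast; ring
    have hrc : r ≤ c := by
      by_contra! hlt
      have hd : 0 < r ^ 2 - c ^ 2 := by nlinarith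
      have w1 : (j * a ^ 2 + b ^ 2) ^ 2 ≤ (k:ℝ) * (j * (a ^ 2) ^ 2 + (b ^ 2) ^ 2) := by
        rw [hkr]
        have v1 : 0 ≤ (j:ℝ) * (a ^ 2 - b ^ 2) ^ 2 := by positivity
        nlinarith
      have w2 : (j * a ^ 2 + b ^ 2) = k * p ^ 2 + (r ^ 2 - c ^ 2) := by linarith
      have w3 : (j * (a ^ 2) ^ 2 + (b ^ 2) ^ 2) =
        k * (p ^ 2) ^ 2 + ((r ^ 2) ^ 2 - (c ^ 2) ^ 2) := by linarith
      rw [w2, w3] at w1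
      have w4 : (r ^ 2 - c ^ 2) * (2 * k * p ^ 2 + (r ^ 2 - c ^ 2)) ≤
        (r ^ 2 - c ^ 2) * (k * (r ^ 2 + c ^ 2)) := by linarith
      have w5 := le_of_mul_le_mul_left w4 hd
      have w6 : (k:ℝ) * (r ^ 2 + c ^ 2) ≤ k * (2 * p ^ 2) := by
        apply mul_le_mul_of_nonneg_left _ (by linarith); linarith
      linarith
    have key : ∀ x : ℝ, r ≤ x → 0 ≤ (x - r) * (x - p) ^ 2 * (x + 2 * p + r) := by
      intro x hx
      exact mul_nonneg (mul_nonneg (by linarith) (sq_nonneg _)) (by linarith)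
    have ka := mul_nonneg (show (0:ℝ) ≤ j by linarith) (key a (by linarith))
    have kb := key b (by linarith)
    have kc := key c (by linarith)
    have hcoef : 0 < (2 * p + r) * (2 * r * p + p ^ 2) - r * p ^ 2 := by
      have : 0 < r * p ^ 2 := by positivity
      have : 0 < p ^ 3 := by positivity
      have : 0 < r ^ 2 * p := by positivity
      nlinarith
    have fin : 0 ≤ ((2 * p + r) * (2 * r * p + p ^ 2) - r * p ^ 2) *
        (j * a + b + c - (k * p + r)) := by
      have ex : ∀ x : ℝ, (x - r) * (x - p) ^ 2 * (x + 2 * p + r) =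
        x ^ 4 + (p ^ 2 + 2 * r * p - (2 * p + r) ^ 2) * x ^ 2 +
        ((2 * p + r) * (2 * r * p + p ^ 2) - r * p ^ 2) * x - r * p ^ 2 * (2 * p + r) := by
        intro x; ring
      have tot := add_nonneg (add_nonneg ka kb) kc
      simp only [ex] at tot
      refine tot.trans_eq ?_
      linear_combination h4 + (p ^ 2 + 2 * r * p - (2 * p + r) ^ 2) * h2 +
        r * p ^ 2 * (2 * p + r) * hkr
    have := nonneg_of_mul_nonneg_right fin hcoef
    linarith
  · have hjk' : j = k := by omega
    subst hjk'
    obtain ⟨s1, s2⟩ := sep h2 g4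
    have hpa : p ≤ a := (sq_le_sq₀ hp.le ha.le).mp s1
    have hbr : b ≤ r := (sq_le_sq₀ hb hr.le).mp s2
    have ka : 0 ≤ (j:ℝ) * (a * (a - r) * (a - p) * (a + r + p)) :=
      mul_nonneg (by linarith) (mul_nonneg (mul_nonneg (mul_nonneg ha.le (by linarith))
        (by linarith)) (by linarith))
    have key : ∀ x : ℝ, 0 ≤ x → x ≤ r → 0 ≤ x * (x - r) * (x - p) * (x + r + p) := by
      intro x h0 h1
      have : 0 ≤ x * (r - x) * (p - x) * (x + r + p) :=
        mul_nonneg (mul_nonneg (mul_nonneg h0 (by linarith)) (by linarith)) (by linarith)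
      linarith
    have tot := add_nonneg (add_nonneg ka (key b hb hbr)) (key c hc (hcb.trans hbr))
    have fin : 0 ≤ (r * p * (r + p)) * (j * a + b + c - (j * p + r)) := by
      refine tot.trans_eq ?_
      linear_combination h4 - (r ^ 2 + r * p + p ^ 2) * h2
    have := nonneg_of_mul_nonneg_right fin (by positivity)
    linarith

set_option maxHeartbeats 2000000 in
theorem aux_main {ι : Type*} [DecidableEq ι] (lam : ι → ℝ) (hpos : ∀ i, 0 ≤ lam i)
    (s : Finset ι) : ∀ (k : ℕ) (p r : ℝ), 1 ≤ k → 0 ≤ r → r < p →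
      ∑ i ∈ s, lam i ^ 2 = k * p ^ 2 + r ^ 2 → ∑ i ∈ s, lam i ^ 4 = k * p ^ 4 + r ^ 4 →
      k * p + r ≤ ∑ i ∈ s, lam i := by
  induction s using Finset.induction_on_min_value lam with
  | empty =>
    intro k p r hk hr hrp h2 h4
    have hK : (1 : ℝ) ≤ k := by exact_mod_cast hk
    have : 0 < (k:ℝ) * p ^ 2 + r ^ 2 := by
      have : 0 < p := by linarith
      positivity
    simp at h2
    linarith
  | insert z s hz hmin ih =>
    intro k p r hk hr hrp h2 h4
    have hK : (1 : ℝ) ≤ k := by exact_mod_cast hk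
    have hp : 0 < p := by linarith
    rcases hr.eq_or_lt with hr0 | hr0
    · subst hr0
      have key : 0 ≤ ∑ i ∈ insert z s,
          (lam i ^ 4 - 3 * p ^ 2 * lam i ^ 2 + 2 * p ^ 3 * lam i) := by
        apply Finset.sum_nonneg
        intro i _
        have := hpos i
        have : 0 ≤ lam i * (lam i - p) ^ 2 * (lam i + 2 * p) := by positivity
        linarith
      rw [Finset.sum_add_distrib, Finset.sum_sub_distrib, ← Finset.mul_sum, ← Finset.mul_sum,
        h2, h4] at key
      have fin : 0 ≤ (2 * p ^ 3) * ((∑ i ∈ insert z s, lam i) - (k * p + 0)) := by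
        refine key.trans_eq ?_; ring
      have := nonneg_of_mul_nonneg_right fin (by positivity)
      linarith
    rw [Finset.sum_insert hz] at h2 h4 ⊢
    have hx0 : 0 ≤ ∑ i ∈ s, lam i ^ 2 := Finset.sum_nonneg fun i _ => sq_nonneg _
    have hxy : ∑ i ∈ s, lam i ^ 4 ≤ (∑ i ∈ s, lam i ^ 2) ^ 2 := by
      have := Finset.sum_sq_le_sq_sum_of_nonneg (s := s) (f := fun i => lam i ^ 2)
        (fun i _ => sq_nonneg _)
      simpa only [← pow_mul] using this
    have hzy : lam z ^ 2 * ∑ i ∈ s, lam i ^ 2 ≤ ∑ i ∈ s, lam i ^ 4 := by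
      rw [Finset.mul_sum]
      apply Finset.sum_le_sum
      intro i hi
      have h1 : lam z ^ 2 ≤ lam i ^ 2 := pow_le_pow_left₀ (hpos z) (hmin i hi) 2
      nlinarith [sq_nonneg (lam i)]
    have hy0 : 0 < ∑ i ∈ s, lam i ^ 2 → 0 < ∑ i ∈ s, lam i ^ 4 := by
      intro h
      refine lt_of_le_of_ne (Finset.sum_nonneg fun i _ => by positivity) ?_
      intro h'
      have := (Finset.sum_eq_zero_iff_of_nonneg (fun i _ => by positivity)).mp h'.symm
      have h0 : ∑ i ∈ s, lam i ^ 2 = 0 := Finset.sum_eq_zero fun i hi => by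
        have := this i hi
        have : lam i = 0 := by simpa using this
        simp [this]
      linarith
    rcases hx0.eq_or_lt with hx | hx
    · exfalso
      rw [← hx] at h2 hxy
      have hy : ∑ i ∈ s, lam i ^ 4 = 0 :=
        le_antisymm (by simpa using hxy) (Finset.sum_nonneg fun i _ => by positivity)
      rw [hy] at h4
      have e : (k * p ^ 2 + r ^ 2) ^ 2 = k * p ^ 4 + r ^ 4 := by
        rw [← h2, ← h4]; ring
      have : 0 < (k:ℝ) * p ^ 2 * r ^ 2 := by positivity
      have : 0 ≤ (k:ℝ) * (k - 1) * p ^ 4 :=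
        mul_nonneg (mul_nonneg (by linarith) (by linarith)) (by positivity)
      nlinarith
    · obtain ⟨hj, g1, g2⟩ := aux_floor _ _ (hy0 hx) hxy _ rfl
      obtain ⟨a, b, hb, hba, e2, e4, -, -⟩ := aux_exists _ hj _ _ hx g1 g2 _ rfl
      generalize ⌊(∑ i ∈ s, lam i ^ 2) ^ 2 / (∑ i ∈ s, lam i ^ 4)⌋₊ = j at *
      have I := ih j a b hj hb hba e2.symm e4.symm
      have hJ : (1 : ℝ) ≤ j := by exact_mod_cast hj
      have ha : 0 < a := by linarith
      have hza : lam z ≤ a := by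
        by_contra! hlt
        have q1 : a ^ 2 < lam z ^ 2 := by gcongr
        rw [← e2, ← e4] at hzy
        have q2 : 0 < (j:ℝ) * (a ^ 2 * (lam z ^ 2 - a ^ 2)) :=
          mul_pos (by linarith) (mul_pos (by positivity) (by linarith))
        have q3 : b ^ 2 ≤ a ^ 2 := by gcongr
        have q4 : 0 ≤ b ^ 2 * (lam z ^ 2 - b ^ 2) :=
          mul_nonneg (by positivity) (by linarith)
        nlinarith
      rw [← e2] at h2
      rw [← e4] at h4
      rcases le_total (lam z) b with hzb | hzb
      · have := aux_three j k hj hk a b (lam z) p r (hpos z) hzb hba.le ha hr0 hrp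
          (by linarith) (by linarith)
        linarith
      · have := aux_three j k hj hk a (lam z) b p r hb hzb hza ha hr0 hrp
          (by linarith) (by linarith)
        linarith


/-- Given a nonnegative vector `λ : Fin L → ℝ` with `∑ λᵢ² = M₂ > 0` and `∑ λᵢ⁴ = M₄`,
setting `q = ⌊M₂²/M₄⌋` and `U = √(q(q+1)M₄ − qM₂²)`, the sum `∑ λᵢ` is bounded below by
`E₄ = √(q(qM₂+U)/(q+1)) + √((M₂−U)/(q+1))`. -/
theorem sum_ge_E4 (L : ℕ) (hL : 1 ≤ L) (lam : Fin L → ℝ) (M₂ M₄ : ℝ)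
    (hpos : ∀ i, 0 ≤ lam i)
    (h2 : ∑ i, lam i ^ 2 = M₂) (h4 : ∑ i, lam i ^ 4 = M₄) (hM2 : 0 < M₂)
    (q : ℕ) (hq : q = ⌊M₂ ^ 2 / M₄⌋₊)
    (U : ℝ) (hU : U = Real.sqrt ((q : ℝ) * ((q : ℝ) + 1) * M₄ - (q : ℝ) * M₂ ^ 2)) :
    Real.sqrt ((q : ℝ) * ((q : ℝ) * M₂ + U) / ((q : ℝ) + 1)) +
        Real.sqrt ((M₂ - U) / ((q : ℝ) + 1)) ≤
      ∑ i, lam i := by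
  have hxy : M₄ ≤ M₂ ^ 2 := by
    have := Finset.sum_sq_le_sq_sum_of_nonneg (s := Finset.univ) (f := fun i => lam i ^ 2)
      (fun i _ => sq_nonneg _)
    rw [← h2, ← h4]
    simpa only [← pow_mul] using this
  have hy : 0 < M₄ := by
    rw [← h4]
    refine lt_of_le_of_ne (Finset.sum_nonneg fun i _ => by positivity) ?_
    intro h'
    have := (Finset.sum_eq_zero_iff_of_nonneg (fun i _ => by positivity)).mp h'.symm
    have h0 : ∑ i, lam i ^ 2 = 0 := Finset.sum_eq_zero fun i hi => by
      have := this i hi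
      have : lam i = 0 := by simpa using this
      simp [this]
    linarith
  obtain ⟨hj, g1, g2⟩ := aux_floor _ _ hy hxy q hq
  obtain ⟨p, r, hr, hrp, e2, e4, s1, s2⟩ := aux_exists q hj _ _ hM2 g1 g2 U hU
  rw [s1, s2]
  exact aux_main lam hpos Finset.univ q p r hj hr hrp (h2.trans e2.symm) (h4.trans e4.symm)
end

section
/- Let ρ be a separable bipartite density matrix on (Fin dA × Fin dB), with reduced density matrices ρ_A and ρ_B (partial traces over B and A respectively). Let Δ = ρ − ρ_A ⊗ ρ_B (Kronecker product), let R be the realignment of Δ, M₂ = trace(R Rᴴ) and M₄ = trace((R Rᴴ)²), and assume M₂ > 0. Then with k = ⌊M₂²/M₄⌋ and U = √(k(k+1)M₄ − kM₂²), one has √(k(kM₂+U)/(k+1)) + √((M₂−U)/(k+1)) ≤ √((1 − trace(ρ_A²))(1 − trace(ρ_B²))). That is, the moment-based enhanced realignment indicator E₄*(ρ) of a separable state is bounded by the geometric mean of the local linear entropies. -/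
open Matrix ComplexOrder Kronecker

/-- The realignment of a bipartite matrix. -/
noncomputable def realign {dA dB : ℕ}
    (ρ : Matrix (Fin dA × Fin dB) (Fin dA × Fin dB) ℂ) :
    Matrix (Fin dA × Fin dA) (Fin dB × Fin dB) ℂ :=
  Matrix.of fun p q => ρ (p.1, q.1) (p.2, q.2)

/-- The reduced density matrix of the first party (partial trace over `B`). -/
noncomputable def reducedA {dA dB : ℕ}
    (ρ : Matrix (Fin dA × Fin dB) (Fin dA × Fin dB) ℂ) : Matrix (Fin dA) (Fin dA) ℂ :=
  Matrix.of fun i i' => ∑ j, ρ (i, j) (i', j)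

/-- The reduced density matrix of the second party (partial trace over `A`). -/
noncomputable def reducedB {dA dB : ℕ}
    (ρ : Matrix (Fin dA × Fin dB) (Fin dA × Fin dB) ℂ) : Matrix (Fin dB) (Fin dB) ℂ :=
  Matrix.of fun j j' => ∑ i, ρ (i, j) (i, j')

lemma le_of_sq_aux {a b : ℝ} (h : a ^ 2 ≤ b ^ 2) (hb : 0 ≤ b) : a ≤ b :=
  (le_abs_self a).trans (abs_le_of_sq_le_sq h hb)

lemma three_move (u v w : ℝ) (huv : v < u) (hvw : w ≤ v) (hw : 0 < w) :
    ∃ u' v' w' : ℝ, 0 ≤ u' ∧ 0 ≤ v' ∧ 0 ≤ w' ∧ u' + v' + w' = u + v + w ∧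
      u' ^ 2 + v' ^ 2 + w' ^ 2 = u ^ 2 + v ^ 2 + w ^ 2 ∧
      u' ^ 4 + v' ^ 4 + w' ^ 4 < u ^ 4 + v ^ 4 + w ^ 4 := by
  have hu : 0 < u := by linarith
  obtain ⟨e, he0, hew, heD⟩ : ∃ e : ℝ, 0 < e ∧ e ≤ w ∧ 7 * u * e ≤ (u - v) ^ 2 := by
    have h1 : 0 < (u - v) ^ 2 / (7 * u) := by
      have : 0 < u - v := by linarith
      positivity
    refine ⟨min w ((u - v) ^ 2 / (7 * u)), lt_min hw h1, min_le_left _ _, ?_⟩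
    calc 7 * u * min w ((u - v) ^ 2 / (7 * u)) ≤ 7 * u * ((u - v) ^ 2 / (7 * u)) := by
          gcongr; exact min_le_right _ _
      _ = (u - v) ^ 2 := by field_simp
  obtain ⟨D, hD⟩ : ∃ D, D = 2 * (u ^ 2 + v ^ 2 + w ^ 2 - (w - e) ^ 2) - (u + v + e) ^ 2 :=
    ⟨_, rfl⟩
  have hD0 : 0 ≤ D := by
    have h1 : e * e ≤ u * e := by nlinarith
    have h2 : v * e ≤ u * e := by nlinarith
    have h3 : 0 < w * e := by positivity
    nlinarith
  have hDs : D ≤ (u + v + e) ^ 2 := by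
    have h3 : w * e ≤ v * e := by nlinarith
    have h4 : 0 < u * v := by apply mul_pos <;> linarith
    have h5 : 0 < u * e := by positivity
    nlinarith
  have hr : Real.sqrt D ≤ u + v + e := by
    apply Real.sqrt_le_iff.2 ⟨by linarith, hDs⟩
  have hr0 := Real.sqrt_nonneg D
  have hr2 : Real.sqrt D ^ 2 = D := Real.sq_sqrt hD0
  generalize Real.sqrt D = r at *
  refine ⟨(u + v + e + r) / 2, (u + v + e - r) / 2, w - e, by linarith, by linarith, by linarith,
    by ring, by nlinarith, ?_⟩
  have key : ((u + v + e + r) / 2) ^ 4 + ((u + v + e - r) / 2) ^ 4 + (w - e) ^ 4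
      = u ^ 4 + v ^ 4 + w ^ 4 - 4 * (u + v + w) * (e * (u - w + e) * (v - w + e)) := by
    have h4 : r ^ 4 = D ^ 2 := by rw [← hr2]; ring
    have : ((u + v + e + r) / 2) ^ 4 + ((u + v + e - r) / 2) ^ 4 =
       ((u + v + e) ^ 4 + 6 * (u + v + e) ^ 2 * r ^ 2 + r ^ 4) / 8 := by ring
    rw [this, h4, hr2, hD]; ring
  rw [key]
  have h1 : 0 < u - w + e := by linarith
  have h2 : 0 < v - w + e := by linarith
  have h3 : 0 < u + v + w := by linarith
  have : 0 < 4 * (u + v + w) * (e * (u - w + e) * (v - w + e)) := by positivity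
  linarith

lemma exists_min_form {κ : Type*} [Fintype κ] (x : κ → ℝ) (hx : ∀ i, 0 ≤ x i)
    (hpos : 0 < ∑ i, x i ^ 2) :
    ∃ (m : ℕ) (a b : ℝ), 1 ≤ m ∧ 0 ≤ b ∧ b < a ∧ m * a + b = ∑ i, x i ∧
      m * a ^ 2 + b ^ 2 = ∑ i, x i ^ 2 ∧ m * a ^ 4 + b ^ 4 ≤ ∑ i, x i ^ 4 := by
  classical
  set T := ∑ i, x i with hT
  set S := ∑ i, x i ^ 2 with hS
  let K : Set (κ → ℝ) := {y | (∀ i, 0 ≤ y i) ∧ ∑ i, y i = T ∧ ∑ i, y i ^ 2 = S}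
  have hK : IsCompact K := by
    have hsub : K ⊆ Set.Icc (fun _ => 0) (fun _ => T) := by
      rintro y ⟨h0, h1, -⟩
      refine ⟨fun i => h0 i, fun i => ?_⟩
      change y i ≤ T
      rw [← h1]
      exact Finset.single_le_sum (fun j _ => h0 j) (Finset.mem_univ i)
    refine isCompact_Icc.of_isClosed_subset ?_ hsub
    have e : K = (⋂ i, {y : κ → ℝ | 0 ≤ y i}) ∩ ({y | ∑ i, y i = T} ∩ {y | ∑ i, y i ^ 2 = S}) := by
      ext y; simp [K]
    rw [e]
    refine IsClosed.inter (isClosed_iInter fun i => isClosed_le continuous_const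
      (continuous_apply i)) (IsClosed.inter (isClosed_eq (by fun_prop) continuous_const)
      (isClosed_eq (by fun_prop) continuous_const))
  obtain ⟨y, ⟨hy0, hyT, hyS⟩, hmin⟩ := hK.exists_isMinOn ⟨x, hx, rfl, rfl⟩
    (f := fun y : κ → ℝ => ∑ i, y i ^ 4) (by fun_prop)
  have hle : ∑ i, y i ^ 4 ≤ ∑ i, x i ^ 4 := hmin (show x ∈ K from ⟨hx, rfl, rfl⟩)
  have hthree : ∀ i j l, y j < y i → y l ≤ y j → 0 < y l → j ≠ l → False := by
    intro i j l h1 h2 h3 hjl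
    have hij : i ≠ j := by rintro rfl; exact lt_irrefl _ h1
    have hil : i ≠ l := by rintro rfl; linarith
    obtain ⟨u, v, w, hu, hv, hw, e1, e2, e4⟩ := three_move _ _ _ h1 h2 h3
    let z : κ → ℝ := fun t => if t = i then u else if t = j then v else if t = l then w else y t
    have zi : z i = u := by simp [z]
    have zj : z j = v := by simp [z, hij.symm]
    have zl : z l = w := by simp [z, hil.symm, hjl.symm]
    have hsum : ∀ f : ℝ → ℝ, ∑ t, f (z t) - ∑ t, f (y t) =
        (f u + f v + f w) - (f (y i) + f (y j) + f (y l)) := by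
      intro f
      rw [← Finset.sum_sub_distrib]
      rw [← Finset.sum_subset (Finset.subset_univ ({i, j, l} : Finset κ))]
      · rw [Finset.sum_insert (by simp [hij, hil]), Finset.sum_insert (by simp [hjl]),
          Finset.sum_singleton, zi, zj, zl]; ring
      · intro t _ ht
        simp only [Finset.mem_insert, Finset.mem_singleton, not_or] at ht
        simp [z, ht.1, ht.2.1, ht.2.2]
    have hz : z ∈ K := by
      refine ⟨fun t => ?_, ?_, ?_⟩
      · simp only [z]; split_ifs <;> first | assumption | exact hy0 t
      · have := hsum id
        simp only [id] at this; linarith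
      · have := hsum (fun t => t ^ 2)
        linarith
    have h5 : ∑ t, y t ^ 4 ≤ ∑ t, z t ^ 4 := hmin hz
    have := hsum (fun t => t ^ 4)
    linarith
  have hne : Nonempty κ := by
    by_contra h
    rw [not_nonempty_iff] at h
    simp [S] at hpos
  obtain ⟨i0, hi0⟩ := Finite.exists_max y
  have ha : 0 < y i0 := by
    by_contra h
    have : ∀ i, y i = 0 := fun i => le_antisymm ((hi0 i).trans (not_lt.1 h)) (hy0 i)
    rw [← hyS] at hpos
    simp [this] at hpos
  let I := Finset.univ.filter (fun i => y i = y i0)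
  have hI : 1 ≤ I.card := Finset.card_pos.2 ⟨i0, by simp [I]⟩
  obtain ⟨b, hb0, hba, hb⟩ : ∃ b, 0 ≤ b ∧ b < y i0 ∧ ∀ f : ℝ → ℝ, f 0 = 0 →
      ∑ i ∈ Finset.univ.filter (fun i => ¬ y i = y i0), f (y i) = f b := by
    by_cases h : ∃ j, 0 < y j ∧ y j < y i0
    · obtain ⟨j, hj0, hj⟩ := h
      refine ⟨y j, hj0.le, hj, fun f hf => ?_⟩
      apply Finset.sum_eq_single j
      · intro l hl hlj
        have hl' : y l < y i0 := lt_of_le_of_ne (hi0 l) (by simpa using hl)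
        rcases (hy0 l).eq_or_lt with h0 | h0
        · rw [← h0, hf]
        · exfalso
          rcases le_total (y l) (y j) with h | h
          · exact hthree i0 j l hj h h0 hlj.symm
          · exact hthree i0 l j hl' h hj0 hlj
      · intro h
        exact absurd hj.ne (by simpa using h)
    · push Not at h
      refine ⟨0, le_rfl, ha, fun f hf => ?_⟩
      rw [hf]
      apply Finset.sum_eq_zero
      intro l hl
      have hl' : y l < y i0 := lt_of_le_of_ne (hi0 l) (by simpa using hl)
      rcases (hy0 l).eq_or_lt with h0 | h0
      · rw [← h0, hf]
      · exact absurd (h l h0) (not_le.2 hl')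
  have hall : ∀ f : ℝ → ℝ, f 0 = 0 → ∑ i, f (y i) = I.card * f (y i0) + f b := by
    intro f hf
    rw [← Finset.sum_filter_add_sum_filter_not Finset.univ (fun i => y i = y i0), hb f hf]
    congr 1
    rw [Finset.sum_congr rfl (g := fun _ => f (y i0))]
    · simp [I]
    · intro i hi
      rw [(Finset.mem_filter.1 hi).2]
  refine ⟨I.card, y i0, b, hI, hb0, hba, ?_, ?_, ?_⟩
  · rw [← hyT]; exact (hall id rfl).symm
  · rw [← hyS]; exact (hall (fun t => t ^ 2) (by simp)).symm
  · refine le_trans (le_of_eq ?_) hle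
    exact (hall (fun t => t ^ 4) (by simp)).symm

set_option maxHeartbeats 1000000 in
lemma E4_le_form (m k : ℕ) (a b M₂ M₄ U : ℝ) (hm : 1 ≤ m) (hb : 0 ≤ b) (hba : b < a)
    (h2 : m * a ^ 2 + b ^ 2 = M₂) (h4 : m * a ^ 4 + b ^ 4 ≤ M₄) (hM : M₄ ≤ M₂ ^ 2)
    (hk : k = ⌊M₂ ^ 2 / M₄⌋₊)
    (hU : U = Real.sqrt ((k : ℝ) * ((k : ℝ) + 1) * M₄ - (k : ℝ) * M₂ ^ 2)) :
    Real.sqrt ((k : ℝ) * ((k : ℝ) * M₂ + U) / ((k : ℝ) + 1)) +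
        Real.sqrt ((M₂ - U) / ((k : ℝ) + 1)) ≤ m * a + b := by
  have ha : 0 < a := by linarith
  have hm' : (1 : ℝ) ≤ m := by exact_mod_cast hm
  have hM4 : 0 < M₄ := lt_of_lt_of_le (by positivity) h4
  have hM2 : 0 < M₂ := by rw [← h2]; positivity
  have hk1 : 1 ≤ k := by
    rw [hk]; apply Nat.le_floor; rw [Nat.cast_one, one_le_div hM4]; exact hM
  have hkle : (k : ℝ) * M₄ ≤ M₂ ^ 2 := by
    rw [← le_div_iff₀ hM4, hk]; exact Nat.floor_le (by positivity)
  have hklt : M₂ ^ 2 < (k + 1) * M₄ := by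
    rw [← div_lt_iff₀ hM4, hk]; exact Nat.lt_floor_add_one _
  have hk1' : (1 : ℝ) ≤ k := by exact_mod_cast hk1
  have hbb : b ^ 2 < a ^ 2 := by nlinarith
  have hkm : k ≤ m := by
    by_contra h
    have h1 : (m : ℝ) + 1 ≤ k := by exact_mod_cast not_le.1 h
    have h3 : ((m : ℝ) + 1) * (m * a ^ 4 + b ^ 4) ≤ (m * a ^ 2 + b ^ 2) ^ 2 := by
      rw [h2]
      refine le_trans ?_ hkle
      gcongr
    have : 0 < m * (a ^ 2 - b ^ 2) ^ 2 := by
      have : 0 < a ^ 2 - b ^ 2 := by linarith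
      positivity
    nlinarith
  have hU0 : 0 ≤ U := by rw [hU]; exact Real.sqrt_nonneg _
  have hU2 : U ^ 2 = (k : ℝ) * ((k : ℝ) + 1) * M₄ - (k : ℝ) * M₂ ^ 2 := by
    rw [hU, Real.sq_sqrt]; nlinarith
  have hUM : U ≤ M₂ := by
    apply le_of_sq_aux _ hM2.le
    rw [hU2]; nlinarith
  obtain ⟨B, hB⟩ : ∃ B, B = (M₂ - U) / ((k : ℝ) + 1) := ⟨_, rfl⟩
  have hUB : U = M₂ - (k + 1) * B := by rw [hB]; field_simp; ring
  have hB0 : 0 ≤ B := by rw [hB]; apply div_nonneg <;> linarith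
  have hBM : (k + 1) * B ≤ M₂ := by linarith
  have hMB : 0 ≤ M₂ - B := by nlinarith
  have e1 : (k : ℝ) * ((k : ℝ) * M₂ + U) / ((k : ℝ) + 1) = k * (M₂ - B) := by
    rw [hUB]; field_simp; ring
  rw [e1, ← hB]
  have hs1 := Real.sq_sqrt hB0
  have hs2 := Real.sq_sqrt (mul_nonneg (by linarith : (0 : ℝ) ≤ k) hMB)
  have hs10 := Real.sqrt_nonneg B
  have hs20 := Real.sqrt_nonneg (k * (M₂ - B))
  generalize Real.sqrt B = β at *
  generalize Real.sqrt (k * (M₂ - B)) = γ at *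
  rcases hkm.lt_or_eq with hlt | rfl
  · have hlt' : (k : ℝ) + 1 ≤ m := by exact_mod_cast hlt
    have h5 : (γ + β) ^ 2 ≤ (k + 1) * M₂ := by
      have : 0 ≤ (γ - k * β) ^ 2 := sq_nonneg _
      have h6 : k * (γ + β) ^ 2 ≤ k * ((k + 1) * M₂) := by
        have h7 : k * M₂ = γ ^ 2 + k * β ^ 2 := by rw [hs1, hs2]; ring
        have h8 : k * ((k + 1) * M₂) = (k + 1) * (γ ^ 2 + k * β ^ 2) := by rw [← h7]; ring
        rw [h8]; linarith
      exact le_of_mul_le_mul_left h6 (by linarith)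
    have h6 : m * M₂ ≤ (m * a + b) ^ 2 := by
      rw [← h2]
      have : b * b ≤ a * b := by nlinarith
      nlinarith [mul_nonneg (by linarith : (0 : ℝ) ≤ m) (sub_nonneg.2 this), mul_nonneg ha.le hb]
    have h7 : (γ + β) ^ 2 ≤ (m * a + b) ^ 2 := by nlinarith
    exact le_of_sq_aux h7 (by positivity)
  · have h5 : (M₂ - (k + 1) * b ^ 2) ^ 2 ≤ U ^ 2 := by
      rw [hU2]
      have : (k : ℝ) * (k + 1) * (k * a ^ 4 + b ^ 4) ≤ k * (k + 1) * M₄ := by gcongr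
      have e : (M₂ - (k + 1) * b ^ 2) ^ 2 =
          (k : ℝ) * (k + 1) * (k * a ^ 4 + b ^ 4) - k * M₂ ^ 2 := by rw [← h2]; ring
      linarith
    have h6 := le_of_sq_aux h5 hU0
    have h7 : B ≤ b ^ 2 := by
      have : (k + 1) * B ≤ (k + 1) * b ^ 2 := by linarith
      exact le_of_mul_le_mul_left this (by positivity)
    have h8 : β ≤ b := le_of_sq_aux (by linarith) hb
    -- γ² + k β² = (k a)² + k b²
    have h9 : (γ - k * a) * (γ + k * a) = k * ((b - β) * (b + β)) := by
      
      have : (γ - k * a) * (γ + k * a) = γ ^ 2 - (k * a) ^ 2 := by ring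
      rw [this, hs2, ← h2, ← hs1]; ring
    have h10 : b + β ≤ 2 * a := by linarith
    have hγ : k * a ≤ γ := by
      apply le_of_sq_aux _ hs20
      nlinarith [mul_nonneg (sub_nonneg.2 h8) (by linarith : 0 ≤ b + β)]
    have hγβ : k * (b + β) ≤ γ + k * a := by
      have h12 : k * b ≤ k * a := mul_le_mul_of_nonneg_left hba.le (by linarith)
      have h13 : k * β ≤ k * a := mul_le_mul_of_nonneg_left (by linarith) (by linarith)
      linarith
    by_contra hcon
    push Not at hcon
    have h11 : b - β < γ - k * a := by linarith
    have : k * ((b - β) * (b + β)) < (γ - k * a) * (γ + k * a) := by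
      calc k * ((b - β) * (b + β)) = (b - β) * (k * (b + β)) := by ring
        _ ≤ (b - β) * (γ + k * a) := by
            apply mul_le_mul_of_nonneg_left hγβ; linarith
        _ < _ := by apply mul_lt_mul_of_pos_right h11; positivity
    linarith
lemma trace_sq_eigen {n : Type*} [Fintype n] [DecidableEq n] {H : Matrix n n ℂ}
    (hH : H.IsHermitian) : (H ^ 2).trace = ((∑ i, hH.eigenvalues i ^ 2 : ℝ) : ℂ) := by
  conv_lhs => rw [hH.spectral_theorem, ← map_pow, Unitary.conjStarAlgAut_apply,
    Matrix.trace_mul_comm, ← mul_assoc, Unitary.coe_star_mul_self, one_mul]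
  rw [Matrix.diagonal_pow, Matrix.trace_diagonal]
  simp

lemma trace_sq_le_one {n : Type*} [Fintype n] [DecidableEq n] {H : Matrix n n ℂ}
    (hH : H.PosSemidef) (h1 : H.trace = 1) : (H ^ 2).trace.re ≤ 1 := by
  rw [trace_sq_eigen hH.isHermitian, Complex.ofReal_re]
  have h2 : ∑ i, hH.isHermitian.eigenvalues i = 1 := by
    have : H.trace = ∑ i, (hH.isHermitian.eigenvalues i : ℂ) :=
      hH.isHermitian.trace_eq_sum_eigenvalues
    rw [h1, ← Complex.ofReal_sum] at this
    exact (Complex.ofReal_eq_one.1 this.symm)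
  have h0 := hH.eigenvalues_nonneg
  calc ∑ i, hH.isHermitian.eigenvalues i ^ 2 ≤ (∑ i, hH.isHermitian.eigenvalues i) ^ 2 :=
        Finset.sum_sq_le_sq_sum_of_nonneg fun i _ => h0 i
    _ = 1 := by rw [h2]; norm_num

lemma variance_le {n ι : Type*} [Fintype n] [DecidableEq n] (s : Finset ι) (p : ι → ℝ)
    (A : ι → Matrix n n ℂ) (hp : ∀ i ∈ s, 0 ≤ p i) (hpsum : ∑ i ∈ s, p i = 1)
    (hA : ∀ i ∈ s, (A i).PosSemidef ∧ (A i).trace = 1)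
    (M : Matrix n n ℂ) (hM : M = ∑ i ∈ s, (p i : ℂ) • A i) :
    ∑ i ∈ s, p i * (∑ x : n × n, ‖(A i - M) x.1 x.2‖ ^ 2) ≤ 1 - (M ^ 2).trace.re := by
  have hMH : M.IsHermitian := by
    rw [hM, Matrix.IsHermitian, Matrix.conjTranspose_sum]
    refine Finset.sum_congr rfl fun i hi => ?_
    rw [Matrix.conjTranspose_smul, (hA i hi).1.isHermitian.eq]
    simp
  have hnorm : ∀ i ∈ s, (∑ x : n × n, ‖(A i - M) x.1 x.2‖ ^ 2) =
      (((A i) ^ 2).trace - (A i * M).trace - (M * A i).trace + (M ^ 2).trace).re := by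
    intro i hi
    have hD : (A i - M).IsHermitian := (hA i hi).1.isHermitian.sub hMH
    have e : ((A i) ^ 2).trace - (A i * M).trace - (M * A i).trace + (M ^ 2).trace =
        ((A i - M) * (A i - M)).trace := by
      simp only [sub_mul, mul_sub, Matrix.trace_sub, sq]; ring
    rw [e, Matrix.trace, Complex.re_sum, Fintype.sum_prod_type]
    refine Finset.sum_congr rfl fun x _ => ?_
    rw [Matrix.diag_apply, Matrix.mul_apply, Complex.re_sum]
    refine Finset.sum_congr rfl fun y _ => ?_
    rw [← hD.apply y x, Complex.star_def, Complex.mul_conj, Complex.ofReal_re,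
      Complex.normSq_eq_norm_sq]
  have e1 : ∑ i ∈ s, p i * (A i * M).trace.re = (M ^ 2).trace.re := by
    conv_rhs => rw [sq]; arg 1; arg 1; arg 1; rw [hM]
    rw [Finset.sum_mul, Matrix.trace_sum, Complex.re_sum]
    refine Finset.sum_congr rfl fun i _ => ?_
    rw [Matrix.smul_mul, Matrix.trace_smul, smul_eq_mul, Complex.re_ofReal_mul]
  have e2 : ∑ i ∈ s, p i * ((A i) ^ 2).trace.re ≤ 1 := by
    rw [← hpsum]
    refine Finset.sum_le_sum fun i hi => ?_
    nlinarith [hp i hi, trace_sq_le_one (hA i hi).1 (hA i hi).2]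
  calc ∑ i ∈ s, p i * (∑ x : n × n, ‖(A i - M) x.1 x.2‖ ^ 2)
      = ∑ i ∈ s, (p i * ((A i) ^ 2).trace.re - 2 * (p i * (A i * M).trace.re)
          + p i * (M ^ 2).trace.re) := by
        refine Finset.sum_congr rfl fun i hi => ?_
        rw [hnorm i hi, Matrix.trace_mul_comm M]
        simp only [Complex.add_re, Complex.sub_re]; ring
    _ = ∑ i ∈ s, p i * ((A i) ^ 2).trace.re - (M ^ 2).trace.re := by
        rw [Finset.sum_add_distrib, Finset.sum_sub_distrib, ← Finset.mul_sum, e1,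
          ← Finset.sum_mul, hpsum]; ring
    _ ≤ _ := by linarith

lemma trace_norm_le {m n ι : Type*} [Fintype m] [Fintype n] [DecidableEq m]
    (s : Finset ι) (p : ι → ℝ) (hp : ∀ i ∈ s, 0 ≤ p i) (R : Matrix m n ℂ)
    (a : ι → EuclideanSpace ℂ m) (c : ι → EuclideanSpace ℂ n)
    (hR : ∀ x y, R x y = ∑ l ∈ s, (p l : ℂ) * a l x * star (c l y))
    (hH : (R * Rᴴ).IsHermitian) (hpsd : (R * Rᴴ).PosSemidef) :
    ∑ i, Real.sqrt (hH.eigenvalues i) ≤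
      Real.sqrt (∑ l ∈ s, p l * ‖a l‖ ^ 2) * Real.sqrt (∑ l ∈ s, p l * ‖c l‖ ^ 2) := by
  classical
  have h0 : ∀ i, 0 ≤ hH.eigenvalues i := hpsd.eigenvalues_nonneg
  let u := hH.eigenvectorBasis
  let w : m → EuclideanSpace ℂ n := fun i => WithLp.toLp 2 (Rᴴ *ᵥ (u i).ofLp)
  have hww : ∀ i j, inner ℂ (w i) (w j) = if i = j then (hH.eigenvalues j : ℂ) else 0 := by
    intro i j
    have h1 : inner ℂ (w i) (w j) = inner ℂ (u i) (WithLp.toLp 2 ((R * Rᴴ) *ᵥ (u j).ofLp)) := by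
      simp only [EuclideanSpace.inner_eq_star_dotProduct, w]
      rw [← Matrix.mulVec_mulVec, Matrix.star_mulVec, Matrix.conjTranspose_conjTranspose,
        dotProduct_comm, ← Matrix.dotProduct_mulVec, dotProduct_comm]
    rw [h1, hH.mulVec_eigenvectorBasis j]
    have h2 : (WithLp.toLp 2 (hH.eigenvalues j • (hH.eigenvectorBasis j).ofLp) :
        EuclideanSpace ℂ m) = (hH.eigenvalues j : ℂ) • u j := by
      ext x; simp [u]
    rw [h2, inner_smul_right, orthonormal_iff_ite.1 u.orthonormal i j]
    split_ifs <;> simp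
  let J := {i // 0 < hH.eigenvalues i}
  let v : J → EuclideanSpace ℂ n := fun i => ((Real.sqrt (hH.eigenvalues i))⁻¹ : ℂ) • w i
  have hv : Orthonormal ℂ v := by
    rw [orthonormal_iff_ite]
    intro i j
    simp only [v]
    rw [inner_smul_left, inner_smul_right, hww]
    by_cases hij : i = j
    · subst hij
      have hs : 0 < Real.sqrt (hH.eigenvalues i) := Real.sqrt_pos.2 i.2
      have hs2 : (hH.eigenvalues i : ℂ) = (Real.sqrt (hH.eigenvalues i) : ℂ) ^ 2 := by
        rw [← Complex.ofReal_pow, Real.sq_sqrt i.2.le]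
      have hs3 : (Real.sqrt (hH.eigenvalues i) : ℂ) ≠ 0 := by exact_mod_cast hs.ne'
      simp only [if_true, map_inv₀, Complex.conj_ofReal]
      rw [hs2]
      field_simp
    · have : (i : m) ≠ j := fun h => hij (Subtype.ext h)
      simp [hij, this]
  have hvw : ∀ i : J, (Real.sqrt (hH.eigenvalues i) : ℂ) = inner ℂ (v i) (w i) := by
    intro i
    have hs : 0 < Real.sqrt (hH.eigenvalues i) := Real.sqrt_pos.2 i.2
    have hs3 : (Real.sqrt (hH.eigenvalues i) : ℂ) ≠ 0 := by exact_mod_cast hs.ne'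
    have hs2 : (hH.eigenvalues i : ℂ) = (Real.sqrt (hH.eigenvalues i) : ℂ) ^ 2 := by
      rw [← Complex.ofReal_pow, Real.sq_sqrt i.2.le]
    simp only [v]
    rw [inner_smul_left, hww]
    simp only [if_true, map_inv₀, Complex.conj_ofReal]
    rw [hs2]
    field_simp
  have hw : ∀ i, w i = ∑ l ∈ s, ((p l : ℂ) * inner ℂ (a l) (u i)) • c l := by
    intro i
    ext y
    simp only [w, Matrix.mulVec, dotProduct, Matrix.conjTranspose_apply, hR, star_sum, star_mul',
      star_star, Finset.sum_mul, WithLp.ofLp_sum, Finset.sum_apply, smul_eq_mul,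
      EuclideanSpace.inner_eq_star_dotProduct, Finset.mul_sum, WithLp.ofLp_smul, Pi.smul_apply]
    rw [Finset.sum_comm]
    refine Finset.sum_congr rfl fun l _ => Finset.sum_congr rfl fun x _ => ?_
    simp
    ring
  have hle : ∀ i : J, Real.sqrt (hH.eigenvalues i) ≤
      ∑ l ∈ s, p l * (‖inner ℂ (u i) (a l)‖ * ‖inner ℂ (v i) (c l)‖) := by
    intro i
    have h1 : Real.sqrt (hH.eigenvalues i) = ‖inner ℂ (v i) (w i)‖ := by
      rw [← hvw i, Complex.norm_real, Real.norm_of_nonneg (Real.sqrt_nonneg _)]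
    rw [h1, hw i, inner_sum]
    refine (norm_sum_le _ _).trans (Finset.sum_le_sum fun l hl => ?_)
    rw [inner_smul_right, norm_mul, norm_mul, Complex.norm_real, Real.norm_of_nonneg (hp l hl),
      norm_inner_symm (a l), mul_assoc]
  have hsum : ∑ i, Real.sqrt (hH.eigenvalues i) = ∑ i : J, Real.sqrt (hH.eigenvalues i) := by
    rw [show (∑ i : J, Real.sqrt (hH.eigenvalues i)) = ∑ i ∈ Finset.univ.filter
      (fun i => 0 < hH.eigenvalues i), Real.sqrt (hH.eigenvalues i) from
        (Finset.sum_subtype (p := fun i => 0 < hH.eigenvalues i) _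
          (fun i => by simp) (fun i => Real.sqrt (hH.eigenvalues i))).symm]
    symm
    apply Finset.sum_subset (Finset.subset_univ _)
    intro i _ hi
    apply Real.sqrt_eq_zero_of_nonpos
    simpa using hi
  have hl : ∀ l, ∑ i : J, ‖inner ℂ (u i) (a l)‖ * ‖inner ℂ (v i) (c l)‖ ≤ ‖a l‖ * ‖c l‖ := by
    intro l
    refine (Real.sum_mul_le_sqrt_mul_sqrt _ _ _).trans ?_
    have hu' : Orthonormal ℂ (fun i : J => u i) :=
      u.orthonormal.comp _ Subtype.val_injective
    refine mul_le_mul ?_ ?_ (Real.sqrt_nonneg _) (norm_nonneg _)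
    · exact Real.sqrt_le_iff.2 ⟨norm_nonneg _, hu'.sum_inner_products_le (a l)⟩
    · exact Real.sqrt_le_iff.2 ⟨norm_nonneg _, hv.sum_inner_products_le (c l)⟩
  calc ∑ i, Real.sqrt (hH.eigenvalues i) = ∑ i : J, Real.sqrt (hH.eigenvalues i) := hsum
    _ ≤ ∑ i : J, ∑ l ∈ s, p l * (‖inner ℂ (u i) (a l)‖ * ‖inner ℂ (v i) (c l)‖) :=
        Finset.sum_le_sum fun i _ => hle i
    _ = ∑ l ∈ s, p l * ∑ i : J, ‖inner ℂ (u i) (a l)‖ * ‖inner ℂ (v i) (c l)‖ := by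
        rw [Finset.sum_comm]
        exact Finset.sum_congr rfl fun l _ => (Finset.mul_sum _ _ _).symm
    _ ≤ ∑ l ∈ s, p l * (‖a l‖ * ‖c l‖) :=
        Finset.sum_le_sum fun l hl' => mul_le_mul_of_nonneg_left (hl l) (hp l hl')
    _ = ∑ l ∈ s, (Real.sqrt (p l) * ‖a l‖) * (Real.sqrt (p l) * ‖c l‖) := by
        refine Finset.sum_congr rfl fun l hl' => ?_
        conv_lhs => rw [← Real.mul_self_sqrt (hp l hl')]
        ring
    _ ≤ _ := by
        refine (Real.sum_mul_le_sqrt_mul_sqrt _ _ _).trans (le_of_eq ?_)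
        congr 2 <;> refine Finset.sum_congr rfl fun l hl' => ?_ <;>
          rw [mul_pow, Real.sq_sqrt (hp l hl')]

/-- For a separable bipartite density matrix `ρ`, the moment-based enhanced realignment
indicator `E₄*` — computed from the second and fourth moments of the realignment of
`Δ = ρ − ρ_A ⊗ ρ_B` — is bounded by the geometric mean of the local linear entropies
`√((1 − trace ρ_A²)(1 − trace ρ_B²))`. -/
theorem separable_enhanced_E4_le {dA dB : ℕ} {ι : Type*} (s : Finset ι)
    (p : ι → ℝ) (A : ι → Matrix (Fin dA) (Fin dA) ℂ) (B : ι → Matrix (Fin dB) (Fin dB) ℂ)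
    (hp : ∀ i ∈ s, 0 ≤ p i) (hpsum : ∑ i ∈ s, p i = 1)
    (hA : ∀ i ∈ s, (A i).PosSemidef ∧ (A i).trace = 1)
    (hB : ∀ i ∈ s, (B i).PosSemidef ∧ (B i).trace = 1)
    (ρ : Matrix (Fin dA × Fin dB) (Fin dA × Fin dB) ℂ)
    (hρ : ρ = ∑ i ∈ s, (p i : ℂ) • (A i ⊗ₖ B i))
    (Δ : Matrix (Fin dA × Fin dB) (Fin dA × Fin dB) ℂ)
    (hΔ : Δ = ρ - reducedA ρ ⊗ₖ reducedB ρ)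
    (M₂ M₄ : ℝ)
    (hM2 : Matrix.trace (realign Δ * (realign Δ)ᴴ) = (M₂ : ℂ))
    (hM4 : Matrix.trace ((realign Δ * (realign Δ)ᴴ) ^ 2) = (M₄ : ℂ))
    (hM2pos : 0 < M₂)
    (k : ℕ) (hk : k = ⌊M₂ ^ 2 / M₄⌋₊)
    (U : ℝ) (hU : U = Real.sqrt ((k : ℝ) * ((k : ℝ) + 1) * M₄ - (k : ℝ) * M₂ ^ 2)) :
    Real.sqrt ((k : ℝ) * ((k : ℝ) * M₂ + U) / ((k : ℝ) + 1)) +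
        Real.sqrt ((M₂ - U) / ((k : ℝ) + 1)) ≤
      Real.sqrt ((1 - (Matrix.trace (reducedA ρ ^ 2)).re) *
        (1 - (Matrix.trace (reducedB ρ ^ 2)).re)) := by
  classical
  have hrA : reducedA ρ = ∑ i ∈ s, (p i : ℂ) • A i := by
    ext x x'
    simp only [reducedA, Matrix.of_apply, hρ, Matrix.sum_apply, Matrix.smul_apply,
      Matrix.kroneckerMap_apply, smul_eq_mul]
    rw [Finset.sum_comm]
    refine Finset.sum_congr rfl fun i hi => ?_
    have := (hB i hi).2
    simp only [Matrix.trace, Matrix.diag_apply] at this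
    rw [← Finset.mul_sum, ← Finset.mul_sum, this, mul_one]
  have hrB : reducedB ρ = ∑ i ∈ s, (p i : ℂ) • B i := by
    ext x x'
    simp only [reducedB, Matrix.of_apply, hρ, Matrix.sum_apply, Matrix.smul_apply,
      Matrix.kroneckerMap_apply, smul_eq_mul]
    rw [Finset.sum_comm]
    refine Finset.sum_congr rfl fun i hi => ?_
    have := (hA i hi).2
    simp only [Matrix.trace, Matrix.diag_apply] at this
    rw [← Finset.mul_sum, ← Finset.sum_mul, this, one_mul]
  have hvA := variance_le s p A hp hpsum hA _ hrA
  have hvB := variance_le s p B hp hpsum hB _ hrB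
  have hpC : ∑ i ∈ s, (p i : ℂ) = 1 := by
    rw [← Complex.ofReal_sum, hpsum, Complex.ofReal_one]
  have hrA' : ∀ x x', reducedA ρ x x' = ∑ i ∈ s, (p i : ℂ) * A i x x' := by
    intro x x'
    rw [hrA]; simp [Matrix.sum_apply]
  have hrB' : ∀ x x', reducedB ρ x x' = ∑ i ∈ s, (p i : ℂ) * B i x x' := by
    intro x x'
    rw [hrB]; simp [Matrix.sum_apply]
  have hρ' : ∀ x x', ρ x x' = ∑ i ∈ s, (p i : ℂ) * (A i x.1 x'.1 * B i x.2 x'.2) := by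
    intro x x'
    rw [hρ]; simp [Matrix.sum_apply]
  generalize reducedA ρ = M at *
  generalize reducedB ρ = N at *
  set R := realign Δ with hRdef
  let a : ι → EuclideanSpace ℂ (Fin dA × Fin dA) := fun i =>
    WithLp.toLp 2 (fun x => (A i - M) x.1 x.2)
  let c : ι → EuclideanSpace ℂ (Fin dB × Fin dB) := fun i =>
    WithLp.toLp 2 (fun x => star ((B i - N) x.1 x.2))
  have hR : ∀ x y, R x y = ∑ l ∈ s, (p l : ℂ) * a l x * star (c l y) := by
    intro x y
    have e1 : R x y = (∑ i ∈ s, (p i : ℂ) * (A i x.1 x.2 * B i y.1 y.2)) -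
        M x.1 x.2 * N y.1 y.2 := by
      simp only [hRdef, realign, hΔ, Matrix.of_apply, Matrix.sub_apply, hρ',
        Matrix.kroneckerMap_apply]
    have e2 : ∀ l, (p l : ℂ) * a l x * star (c l y) =
        (p l : ℂ) * (A l x.1 x.2 * B l y.1 y.2) - ((p l : ℂ) * A l x.1 x.2) * N y.1 y.2
         - M x.1 x.2 * ((p l : ℂ) * B l y.1 y.2) + (p l : ℂ) * (M x.1 x.2 * N y.1 y.2) := by
      intro l
      simp only [a, c, star_star, Matrix.sub_apply]
      ring
    rw [e1, Finset.sum_congr rfl fun l _ => e2 l, Finset.sum_add_distrib,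
      Finset.sum_sub_distrib, Finset.sum_sub_distrib, ← Finset.sum_mul, ← Finset.mul_sum,
      ← Finset.sum_mul, ← hrA', ← hrB', hpC]
    ring
  have hpsd : (R * Rᴴ).PosSemidef := Matrix.posSemidef_self_mul_conjTranspose R
  have hH := hpsd.isHermitian
  have hmain := trace_norm_le s p hp R a c hR hH hpsd
  have h0 : ∀ i, 0 ≤ hH.eigenvalues i := hpsd.eigenvalues_nonneg
  have hna : ∀ l, ‖a l‖ ^ 2 = ∑ x : Fin dA × Fin dA, ‖(A l - M) x.1 x.2‖ ^ 2 := by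
    intro l
    rw [EuclideanSpace.norm_sq_eq]
  have hnc : ∀ l, ‖c l‖ ^ 2 = ∑ x : Fin dB × Fin dB, ‖(B l - N) x.1 x.2‖ ^ 2 := by
    intro l
    rw [EuclideanSpace.norm_sq_eq]
    simp only [c, norm_star]
  have hM2' : ∑ i, hH.eigenvalues i = M₂ := by
    have h : (R * Rᴴ).trace = ∑ i, (hH.eigenvalues i : ℂ) := hH.trace_eq_sum_eigenvalues
    rw [hM2, ← Complex.ofReal_sum] at h
    exact (Complex.ofReal_injective h).symm
  have hM4' : ∑ i, hH.eigenvalues i ^ 2 = M₄ := by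
    have h := trace_sq_eigen hH
    rw [hM4] at h
    exact (Complex.ofReal_injective h).symm
  have hs2 : ∑ i, Real.sqrt (hH.eigenvalues i) ^ 2 = M₂ := by
    rw [← hM2']
    exact Finset.sum_congr rfl fun i _ => Real.sq_sqrt (h0 i)
  have hs4 : ∑ i, Real.sqrt (hH.eigenvalues i) ^ 4 = M₄ := by
    rw [← hM4']
    refine Finset.sum_congr rfl fun i _ => ?_
    rw [show 4 = 2 * 2 from rfl, pow_mul, Real.sq_sqrt (h0 i)]
  have hM : M₄ ≤ M₂ ^ 2 := by
    rw [← hM4', ← hM2']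
    exact Finset.sum_sq_le_sq_sum_of_nonneg fun i _ => h0 i
  obtain ⟨m, α, β, hm, hβ, hβα, f1, f2, f4⟩ :=
    exists_min_form (fun i => Real.sqrt (hH.eigenvalues i)) (fun i => Real.sqrt_nonneg _)
      (by rw [hs2]; exact hM2pos)
  rw [hs2] at f2
  rw [hs4] at f4
  refine (E4_le_form m k α β M₂ M₄ U hm hβ hβα f2 f4 hM hk hU).trans ?_
  rw [f1]
  refine hmain.trans ?_
  simp only [hna, hnc]
  have hn : 0 ≤ ∑ i ∈ s, p i * ∑ x : Fin dA × Fin dA, ‖(A i - M) x.1 x.2‖ ^ 2 :=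
    Finset.sum_nonneg fun i hi => mul_nonneg (hp i hi) (Finset.sum_nonneg fun _ _ => sq_nonneg _)
  rw [Real.sqrt_mul (hn.trans hvA)]
  exact mul_le_mul (Real.sqrt_le_sqrt hvA) (Real.sqrt_le_sqrt hvB) (Real.sqrt_nonneg _)
    (Real.sqrt_nonneg _)
end

section
/- Fix natural numbers L ≥ 1 and l ≤ L and real numbers M₂, M₄. Let C be the set of nonincreasing vectors λ : Fin L → ℝ with λ₁ ≥ λ₂ ≥ ⋯ ≥ λ_L ≥ 0, ∑ᵢ λᵢ² = M₂ and ∑ᵢ λᵢ⁴ = M₄, and suppose C is nonempty. Then there exists λ* ∈ C minimizing the truncated sum ∑_{i=1}^{l} λᵢ over C such that the set of distinct positive values {λ*ᵢ : λ*ᵢ > 0} has at most 3 elements. -/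
/-- The constraint set. -/
def TruncC (L : ℕ) (M₂ M₄ : ℝ) : Set (Fin L → ℝ) :=
  {lam | Antitone lam ∧ (∀ i, 0 ≤ lam i) ∧ (∑ i, lam i ^ 2 = M₂) ∧ (∑ i, lam i ^ 4 = M₄)}

theorem truncC_compact (L : ℕ) (M₂ M₄ : ℝ) : IsCompact (TruncC L M₂ M₄) := by
  have hclosed : IsClosed (TruncC L M₂ M₄) := by
    have h1 : IsClosed {lam : Fin L → ℝ | Antitone lam} := by
      have : {lam : Fin L → ℝ | Antitone lam} =
          ⋂ i, ⋂ j, ⋂ (_ : i ≤ j), {lam : Fin L → ℝ | lam j ≤ lam i} := by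
        ext x; simp [Antitone]
      rw [this]
      refine isClosed_iInter fun i => isClosed_iInter fun j => isClosed_iInter fun _ => ?_
      exact isClosed_le (by fun_prop) (by fun_prop)
    have h2 : IsClosed {lam : Fin L → ℝ | ∀ i, 0 ≤ lam i} := by
      simp only [Set.setOf_forall]
      exact isClosed_iInter fun i => isClosed_le (by fun_prop) (by fun_prop)
    have h3 : IsClosed {lam : Fin L → ℝ | ∑ i, lam i ^ 2 = M₂} :=
      isClosed_eq (by fun_prop) (by fun_prop)
    have h4 : IsClosed {lam : Fin L → ℝ | ∑ i, lam i ^ 4 = M₄} :=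
      isClosed_eq (by fun_prop) (by fun_prop)
    exact h1.inter (h2.inter (h3.inter h4))
  have hK : IsCompact (Set.pi Set.univ (fun _ : Fin L => Set.Icc (0:ℝ) (M₂ + 1))) :=
    isCompact_univ_pi fun _ => isCompact_Icc
  refine hK.of_isClosed_subset hclosed ?_
  rintro x ⟨_, h0, h2, _⟩ i _
  refine ⟨h0 i, ?_⟩
  have : x i ^ 2 ≤ ∑ i, x i ^ 2 :=
    Finset.single_le_sum (f := fun i => x i ^ 2) (fun j _ => sq_nonneg _) (Finset.mem_univ i)
  nlinarith [sq_nonneg (x i - 1)]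

/-- The perturbation direction. -/
noncomputable def pertD {L k : ℕ} (lam : Fin L → ℝ) (v : Fin k → ℝ) (i : Fin L) :
    (Fin k → ℝ) →L[ℝ] ℝ :=
  ∑ j, if lam i = v j then ContinuousLinearMap.proj j else 0

theorem pertD_single {L k : ℕ} (lam : Fin L → ℝ) (v : Fin k → ℝ) (i : Fin L) (j : Fin k) :
    pertD lam v i (Pi.single j 1) = if lam i = v j then 1 else 0 := by
  unfold pertD
  rw [ContinuousLinearMap.sum_apply, Finset.sum_eq_single j]
  · split_ifs <;> simp
  · intro b _ hb
    split_ifs <;> simp [hb]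
  · simp

theorem pert_multipliers {L k : ℕ} (M₂ M₄ : ℝ) (S : Finset (Fin L)) (lam : Fin L → ℝ)
    (hlam : lam ∈ TruncC L M₂ M₄)
    (hmin : ∀ mu ∈ TruncC L M₂ M₄, ∑ i ∈ S, lam i ≤ ∑ i ∈ S, mu i)
    (v : Fin k → ℝ) (hv : ∀ j, 0 < v j) :
    ∃ p q s : ℝ, ¬ (p = 0 ∧ q = 0 ∧ s = 0) ∧ ∀ j,
      ((Finset.univ.filter fun i => lam i = v j).card : ℝ) * (p * v j + q * v j ^ 3)
        + s * ((S.filter fun i => lam i = v j).card : ℝ) = 0 := by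
  obtain ⟨hanti, hnn, h2, h4⟩ := hlam
  set D := pertD lam v with hD
  let g : (Fin k → ℝ) → Fin L → ℝ := fun s i => lam i + D i s
  have hg0 : g 0 = lam := by ext i; simp [g]
  have hgd : ∀ i, HasStrictFDerivAt (fun s => g s i) (D i) 0 := fun i =>
    (D i).hasStrictFDerivAt.const_add (lam i)
  let f : Fin 2 → (Fin k → ℝ) → ℝ := ![fun s => ∑ i, g s i ^ 2, fun s => ∑ i, g s i ^ 4]
  let f' : Fin 2 → (Fin k → ℝ) →L[ℝ] ℝ :=
    ![∑ i, (2 * lam i) • D i, ∑ i, (4 * lam i ^ 3) • D i]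
  have hf' : ∀ i, HasStrictFDerivAt (f i) (f' i) 0 := by
    intro i
    fin_cases i
    · change HasStrictFDerivAt (fun s => ∑ i, g s i ^ 2) (∑ i, (2 * lam i) • D i) 0
      refine HasStrictFDerivAt.fun_sum fun i _ => ?_
      have := (hgd i).pow 2
      simpa [g] using this
    · change HasStrictFDerivAt (fun s => ∑ i, g s i ^ 4) (∑ i, (4 * lam i ^ 3) • D i) 0
      refine HasStrictFDerivAt.fun_sum fun i _ => ?_
      have := (hgd i).pow 4
      simpa [g] using this
  have hφ' : HasStrictFDerivAt (fun s => ∑ i ∈ S, g s i) (∑ i ∈ S, D i) 0 :=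
    HasStrictFDerivAt.fun_sum fun i _ => hgd i
  have hgc : ∀ i, Filter.Tendsto (fun s => g s i) (nhds 0) (nhds (lam i)) := by
    intro i
    have := (hgd i).continuousAt.tendsto
    simpa [hg0] using this
  have hev1 : ∀ᶠ s in nhds (0 : Fin k → ℝ), ∀ i, 0 ≤ g s i := by
    rw [Filter.eventually_all]
    intro i
    rcases (hnn i).eq_or_lt with h | h
    · refine Filter.Eventually.of_forall fun s => ?_
      have : D i = 0 := by
        simp only [hD, pertD]
        refine Finset.sum_eq_zero fun j _ => if_neg ?_
        have := hv j
        rw [← h]; exact this.ne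
      simp [g, this, ← h]
    · filter_upwards [(hgc i).eventually (lt_mem_nhds h)] with s hs using hs.le
  have hev2 : ∀ᶠ s in nhds (0 : Fin k → ℝ), ∀ i j, i ≤ j → g s j ≤ g s i := by
    rw [Filter.eventually_all]
    intro i
    rw [Filter.eventually_all]
    intro j
    rw [Filter.eventually_imp_distrib_left]
    intro hij
    rcases (hanti hij).eq_or_lt with h | h
    · refine Filter.Eventually.of_forall fun s => ?_
      have : D i = D j := by simp only [hD, pertD, h]
      simp [g, this, h]
    · filter_upwards [(hgc j).eventually_lt (hgc i) h] with s hs using hs.le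
  have hloc : IsLocalExtrOn (fun s => ∑ i ∈ S, g s i) {x | ∀ i, f i x = f i 0} 0 := by
    left
    have : ∀ᶠ s in nhdsWithin (0 : Fin k → ℝ) {x | ∀ i, f i x = f i 0},
        ∑ i ∈ S, g 0 i ≤ ∑ i ∈ S, g s i := by
      filter_upwards [self_mem_nhdsWithin, nhdsWithin_le_nhds hev1, nhdsWithin_le_nhds hev2]
        with s hs a1 a2
      rw [hg0]
      refine hmin _ ⟨fun i j hij => a2 i j hij, a1, ?_, ?_⟩
      · have := hs 0
        simp only [f, Matrix.cons_val_zero, hg0] at this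
        rw [this, h2]
      · have := hs 1
        change ∑ i, g s i ^ 4 = ∑ i, g 0 i ^ 4 at this
        rw [this, hg0, h4]
    exact this
  obtain ⟨Λ, Λ₀, hne, heq⟩ := hloc.exists_multipliers_of_hasStrictFDerivAt hf' hφ'
  refine ⟨2 * Λ 0, 4 * Λ 1, Λ₀, ?_, fun j => ?_⟩
  · rintro ⟨h0, h1, h2⟩
    apply hne
    rw [Prod.mk_eq_zero]
    refine ⟨?_, h2⟩
    ext i
    fin_cases i
    · simpa using h0
    · simpa using h1
  · have := congrArg (fun T : (Fin k → ℝ) →L[ℝ] ℝ => T (Pi.single j 1)) heq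
    have e2 : ∀ n : ℕ, ∀ c : ℝ, ∑ i, c * lam i ^ n * (if lam i = v j then (1:ℝ) else 0) =
        ((Finset.univ.filter fun i => lam i = v j).card : ℝ) * (c * v j ^ n) := by
      intro n c
      rw [Finset.card_filter, Nat.cast_sum, Finset.sum_mul]
      refine Finset.sum_congr rfl fun i _ => ?_
      split_ifs with h
      · simp [h]
      · simp
    have e3 : ∑ i ∈ S, (if lam i = v j then (1:ℝ) else 0) =
        ((S.filter fun i => lam i = v j).card : ℝ) := by simp
    have a1 := e2 1 2
    have a2 := e2 3 4
    simp only [pow_one] at a1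
    simp only [Fin.sum_univ_two, f', ContinuousLinearMap.add_apply, ContinuousLinearMap.smul_apply,
      ContinuousLinearMap.sum_apply, Matrix.cons_val_zero, Matrix.cons_val_one, hD, pertD_single,
      smul_eq_mul, ContinuousLinearMap.zero_apply] at this
    rw [a1, a2, e3] at this
    linarith

theorem alg_A {p q s a b c : ℝ} (hab : b < a) (hbc : c < b) (hc : 0 < c)
    (ha' : p * a + q * a ^ 3 + s = 0) (hb' : p * b + q * b ^ 3 + s = 0)
    (hc' : p * c + q * c ^ 3 + s = 0) : p = 0 ∧ q = 0 ∧ s = 0 := by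
  have h1 : p + q * (a^2 + a*b + b^2) = 0 := by
    have : (a - b) * (p + q * (a^2 + a*b + b^2)) = 0 := by linarith
    exact (mul_eq_zero.mp this).resolve_left (by linarith)
  have h2 : p + q * (b^2 + b*c + c^2) = 0 := by
    have : (b - c) * (p + q * (b^2 + b*c + c^2)) = 0 := by linarith
    exact (mul_eq_zero.mp this).resolve_left (by linarith)
  have h3 : ((a - c) * (a + b + c)) * q = 0 := by linarith
  have hq : q = 0 := (mul_eq_zero.mp h3).resolve_left
    (mul_pos (by linarith) (by linarith)).ne'
  subst hq
  have hp : p = 0 := by linarith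
  subst hp
  exact ⟨rfl, rfl, by linarith⟩

theorem alg_B {p q s a b c : ℝ} (hab : b < a) (hbc : c < b) (hc : 0 < c)
    (ha' : p * a + q * a ^ 3 + s = 0) (hb' : p * b + q * b ^ 3 + s = 0)
    (hc' : p * c + q * c ^ 3 = 0) : p = 0 ∧ q = 0 ∧ s = 0 := by
  have h1 : p + q * (a^2 + a*b + b^2) = 0 := by
    have : (a - b) * (p + q * (a^2 + a*b + b^2)) = 0 := by linarith
    exact (mul_eq_zero.mp this).resolve_left (by linarith)
  have h2 : p + q * c^2 = 0 := by
    have : c * (p + q * c^2) = 0 := by linarith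
    exact (mul_eq_zero.mp this).resolve_left hc.ne'
  have h3 : (a^2 + a*b + b^2 - c^2) * q = 0 := by linarith
  have hq : q = 0 := (mul_eq_zero.mp h3).resolve_left (by
    have : 0 < a^2 + a*b + b^2 - c^2 := by nlinarith
    exact this.ne')
  subst hq
  have hp : p = 0 := by linarith
  subst hp
  exact ⟨rfl, rfl, by linarith⟩

theorem alg_C {p q b c : ℝ} (hbc : c < b) (hc : 0 < c)
    (hb' : p * b + q * b ^ 3 = 0) (hc' : p * c + q * c ^ 3 = 0) : p = 0 ∧ q = 0 := by
  have h1 : p + q * b^2 = 0 := by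
    have : b * (p + q * b^2) = 0 := by linarith
    exact (mul_eq_zero.mp this).resolve_left (by linarith)
  have h2 : p + q * c^2 = 0 := by
    have : c * (p + q * c^2) = 0 := by linarith
    exact (mul_eq_zero.mp this).resolve_left hc.ne'
  have h3 : (b^2 - c^2) * q = 0 := by linarith
  have hq : q = 0 := (mul_eq_zero.mp h3).resolve_left (by
    have : 0 < b^2 - c^2 := by nlinarith
    exact this.ne')
  subst hq
  exact ⟨by linarith, rfl⟩

theorem trunc_card (L l : ℕ) (hL : 1 ≤ L) (hl : 1 ≤ l) (M₂ M₄ : ℝ) (lam : Fin L → ℝ)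
    (hlam : lam ∈ TruncC L M₂ M₄)
    (hmin : ∀ mu ∈ TruncC L M₂ M₄,
      ∑ i ∈ Finset.univ.filter (fun i : Fin L => (i : ℕ) < l), lam i ≤
      ∑ i ∈ Finset.univ.filter (fun i : Fin L => (i : ℕ) < l), mu i) :
    ((Finset.image lam Finset.univ).filter fun v => 0 < v).card ≤ 3 := by
  by_contra hcard
  have hcard : 4 ≤ ((Finset.image lam Finset.univ).filter fun v => 0 < v).card := by omega
  let e := Finset.orderEmbOfCardLe _ hcard
  have hmem : ∀ j, e j ∈ (Finset.image lam Finset.univ).filter fun v => 0 < v :=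
    fun j => Finset.orderEmbOfCardLe_mem _ hcard j
  have hpos : ∀ j, 0 < e j := fun j => (Finset.mem_filter.mp (hmem j)).2
  have hex : ∀ j, ∃ i, lam i = e j := fun j => by
    simpa using (Finset.mem_filter.mp (hmem j)).1
  have h01 : e 0 < e 1 := e.strictMono (by decide)
  have h12 : e 1 < e 2 := e.strictMono (by decide)
  have h23 : e 2 < e 3 := e.strictMono (by decide)
  set S := Finset.univ.filter (fun i : Fin L => (i : ℕ) < l) with hS
  let i0 : Fin L := ⟨0, hL⟩
  have hi0S : i0 ∈ S := by simp [hS, i0]; omega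
  have hmax : ∀ j, e j ≤ lam i0 := fun j => by
    obtain ⟨i, hi⟩ := hex j
    rw [← hi]; exact hlam.1 (Fin.mk_le_of_le_val (Nat.zero_le _))
  -- the multipliers
  obtain ⟨p, q, s, hne, hm⟩ := pert_multipliers M₂ M₄ S lam hlam hmin
    ![e 0, e 1, e 2, e 3, lam i0] (by
      intro j
      fin_cases j
      · exact hpos 0
      · exact hpos 1
      · exact hpos 2
      · exact hpos 3
      · exact (hpos 0).trans_le (hmax 0))
  have hNpos : ∀ x, (∃ i, lam i = x) →
      (0:ℝ) < ((Finset.univ.filter fun i => lam i = x).card : ℝ) := by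
    rintro x ⟨i, hi⟩
    exact_mod_cast Finset.card_pos.mpr ⟨i, by simp [hi]⟩
  have htop : ∀ x y, (∃ i ∈ S, lam i = y) → y < x →
      (S.filter fun i => lam i = x) = (Finset.univ.filter fun i => lam i = x) := by
    rintro x y ⟨i, hiS, hi⟩ hxy
    ext k
    simp only [hS, Finset.mem_filter, Finset.mem_univ, true_and] at hiS ⊢
    refine ⟨fun h => h.2, fun h => ⟨?_, h⟩⟩
    by_contra hk
    have hik : i ≤ k := by
      rw [Fin.le_def]; omega
    have := hlam.1 hik
    rw [h, hi] at this
    linarith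
  have hT : ∀ x y, (∃ i ∈ S, lam i = y) → y < x → (∃ i, lam i = x) →
      ((Finset.univ.filter fun i => lam i = x).card : ℝ) * (p * x + q * x ^ 3)
        + s * ((S.filter fun i => lam i = x).card : ℝ) = 0 → p * x + q * x ^ 3 + s = 0 := by
    intro x y hy hxy hx h
    rw [htop x y hy hxy] at h
    have h' : ((Finset.univ.filter fun i => lam i = x).card : ℝ) *
      (p * x + q * x ^ 3 + s) = 0 := by linarith
    exact (mul_eq_zero.mp h').resolve_left (hNpos x hx).ne'
  have hB : ∀ x, (¬ ∃ i ∈ S, lam i = x) → (∃ i, lam i = x) →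
      ((Finset.univ.filter fun i => lam i = x).card : ℝ) * (p * x + q * x ^ 3)
        + s * ((S.filter fun i => lam i = x).card : ℝ) = 0 → p * x + q * x ^ 3 = 0 := by
    intro x hx hx' h
    have : (S.filter fun i => lam i = x) = ∅ := by
      rw [Finset.filter_eq_empty_iff]
      intro i hi h
      exact hx ⟨i, hi, h⟩
    rw [this] at h
    simp only [Finset.card_empty, Nat.cast_zero, mul_zero, add_zero] at h
    exact (mul_eq_zero.mp h).resolve_left (hNpos x hx').ne'
  have m0 := hm 0
  have m1 := hm 1
  have m2 := hm 2
  have m3 := hm 3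
  have m4 := hm 4
  simp only [Matrix.cons_val] at m0 m1 m2 m3 m4
  by_cases c0 : ∃ i ∈ S, lam i = e 0
  · exact hne (alg_A h23 h12 (hpos 1) (hT _ _ c0 (by linarith) (hex 3) m3)
      (hT _ _ c0 (by linarith) (hex 2) m2) (hT _ _ c0 (by linarith) (hex 1) m1))
  by_cases c1 : ∃ i ∈ S, lam i = e 1
  · exact hne (alg_B h23 (h01.trans h12) (hpos 0) (hT _ _ c1 (by linarith) (hex 3) m3)
      (hT _ _ c1 (by linarith) (hex 2) m2) (hB _ c0 (hex 0) m0))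
  obtain ⟨hp, hq⟩ := alg_C h01 (hpos 0) (hB _ c1 (hex 1) m1) (hB _ c0 (hex 0) m0)
  subst hp hq
  have hSp : (0:ℝ) < ((S.filter fun i => lam i = lam i0).card : ℝ) := by
    exact_mod_cast Finset.card_pos.mpr ⟨i0, by simp [hi0S]⟩
  apply hne
  refine ⟨rfl, rfl, ?_⟩
  have : s * ((S.filter fun i => lam i = lam i0).card : ℝ) = 0 := by
    have m5 : ((Finset.univ.filter fun i => lam i = lam i0).card : ℝ) *
      (0 * lam i0 + 0 * lam i0 ^ 3)
        + s * ((S.filter fun i => lam i = lam i0).card : ℝ) = 0 := m4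
    rwa [zero_mul, zero_mul, add_zero, mul_zero, zero_add] at m5
  exact (mul_eq_zero.mp this).resolve_right (ne_of_gt hSp)

/-- Minimizing the truncated sum `∑_{i<l} λᵢ` over nonincreasing nonnegative vectors
`λ : Fin L → ℝ` with prescribed second and fourth power sums (assuming the constraint set
is nonempty): the minimum is attained at some `λ*` whose set of distinct positive values
has at most 3 elements. -/
theorem exists_truncated_minimizer_with_at_most_three_values
    (L l : ℕ) (hL : 1 ≤ L) (hl : l ≤ L) (M₂ M₄ : ℝ)
    (hne : ∃ lam : Fin L → ℝ, Antitone lam ∧ (∀ i, 0 ≤ lam i) ∧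
      (∑ i, lam i ^ 2 = M₂) ∧ (∑ i, lam i ^ 4 = M₄)) :
    ∃ lam : Fin L → ℝ,
      (Antitone lam ∧ (∀ i, 0 ≤ lam i) ∧
        (∑ i, lam i ^ 2 = M₂) ∧ (∑ i, lam i ^ 4 = M₄)) ∧
      (∀ mu : Fin L → ℝ,
        (Antitone mu ∧ (∀ i, 0 ≤ mu i) ∧
          (∑ i, mu i ^ 2 = M₂) ∧ (∑ i, mu i ^ 4 = M₄)) →
        ∑ i ∈ Finset.univ.filter (fun i : Fin L => (i : ℕ) < l), lam i ≤
          ∑ i ∈ Finset.univ.filter (fun i : Fin L => (i : ℕ) < l), mu i) ∧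
      ((Finset.image lam Finset.univ).filter fun v => 0 < v).card ≤ 3 := by
  have key : ∀ l' : ℕ, ∃ lam ∈ TruncC L M₂ M₄, ∀ mu ∈ TruncC L M₂ M₄,
      ∑ i ∈ Finset.univ.filter (fun i : Fin L => (i : ℕ) < l'), lam i ≤
      ∑ i ∈ Finset.univ.filter (fun i : Fin L => (i : ℕ) < l'), mu i := by
    intro l'
    obtain ⟨x, hx, hm⟩ := (truncC_compact L M₂ M₄).exists_isMinOn hne
      (f := fun lam => ∑ i ∈ Finset.univ.filter (fun i : Fin L => (i : ℕ) < l'), lam i)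
      (by fun_prop)
    exact ⟨x, hx, fun mu hmu => hm hmu⟩
  rcases Nat.eq_zero_or_pos l with h0 | h0
  · subst h0
    obtain ⟨x, hx, hm⟩ := key 1
    exact ⟨x, hx, fun mu _ => by simp, trunc_card L 1 hL le_rfl M₂ M₄ x hx hm⟩
  · obtain ⟨x, hx, hm⟩ := key l
    exact ⟨x, hx, fun mu hmu => hm mu hmu, trunc_card L l hL h0 M₂ M₄ x hx hm⟩
end
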